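/- Let G be a finite group of order n and suppose the largest prime divisor of n is 7. If there exists a positive integer k ≥ 13 such that ψ_k(G) > ((1 + 15·2^k + 20·3^k + 24·5^k) / ((1 + 2^k + 2·4^k)(1 + 2·3^k)(1 + 4·5^k))) · ψ_k(ℤ_n), then G is solvable. -/

import Mathlib

/-- `psi G k` is the sum of the `k`-th powers of the orders of the elements of `G`. -/
noncomputable def psi (G : Type*) [Group G] [Fintype G] (k : ℕ) : ℕ :=
  ∑ g : G, orderOf g ^ k

theorem exists_prime_forall_sylow_count_factorial_lt :
    ∀ n ∈ Finset.Icc 2 72, n ≠ 30 → n ≠ 56 → n ≠ 60 →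
    ∃ p ∈ n.primeFactorsList, ∀ t ∈ n.divisors, t % p = 1 → t = 1 ∨ t.factorial < n := by
  decide +kernel

/-- A homomorphism with solvable kernel and solvable range has a solvable source. -/
theorem MonoidHom.isSolvable_of_ker_range {G H : Type*} [Group G] [Group H] (f : G →* H)
    (hk : Group.IsSolvable f.ker) (hr : Group.IsSolvable f.range) : Group.IsSolvable G :=
  Group.isSolvable_of_ker_le_range f.ker.subtype f.rangeRestrict
    (by rw [MonoidHom.ker_rangeRestrict, Subgroup.range_subtype])

/-- Apart from the orders `56` and `60`, groups of order at most `72` are solvable. -/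
theorem Group.isSolvable_of_card_le {G : Type*} [Group G] [Finite G] (hle : Nat.card G ≤ 72)
    (h56 : Nat.card G ≠ 56) (h60 : Nat.card G ≠ 60) : Group.IsSolvable G := by
  induction hN : Nat.card G using Nat.strong_induction_on generalizing G with
  | _ n ih =>
  subst hN
  have key : ∀ (H : Type _) [Group H] [Finite H], Nat.card H ∣ Nat.card G →
      Nat.card H < Nat.card G → Group.IsSolvable H := by
    intro H _ _ hd hlt
    refine ih _ hlt (by omega) ?_ ?_ rfl <;>
    · intro h
      rw [h] at hd hlt
      obtain ⟨c, hc⟩ := hd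
      have : c < 2 := by omega
      interval_cases c <;> omega
  rcases Nat.lt_or_ge (Nat.card G) 2 with h1 | h1
  · have : Nat.card G = 1 := by have := Nat.card_pos (α := G); omega
    have := (Nat.card_eq_one_iff_unique.mp this).1
    infer_instance
  by_cases h30 : Nat.card G = 30
  · have : IsZGroup G := IsZGroup.of_squarefree (by
      rw [h30]; exact (by decide +kernel : Squarefree 30))
    infer_instance
  obtain ⟨p, hp, ht⟩ := exists_prime_forall_sylow_count_factorial_lt _
    (Finset.mem_Icc.2 ⟨h1, hle⟩) h30 h56 h60
  have hpp := Nat.prime_of_mem_primeFactorsList hp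
  have hpd := Nat.dvd_of_mem_primeFactorsList hp
  have : Fact p.Prime := ⟨hpp⟩
  obtain ⟨P⟩ : Nonempty (Sylow p G) := inferInstance
  have hmod : Nat.card (Sylow p G) % p = 1 := by
    have := card_sylow_modEq_one p G
    rwa [Nat.ModEq, Nat.mod_eq_of_lt hpp.one_lt] at this
  have hdiv : Nat.card (Sylow p G) ∣ Nat.card G :=
    P.card_dvd_index.trans (Subgroup.index_dvd_card _)
  by_cases hsub : Nat.card (Sylow p G) = 1
  · have := (Nat.card_eq_one_iff_unique.mp hsub).1
    have hn : (P : Subgroup G).Normal := P.normal_of_subsingleton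
    rw [Group.isSolvable_iff_subgroup_quotient (P : Subgroup G)]
    have hnil := P.isPGroup'.isNilpotent
    refine ⟨inferInstance, key _ (Subgroup.card_quotient_dvd_card _) ?_⟩
    have h2 := Subgroup.card_eq_card_quotient_mul_card_subgroup (P : Subgroup G)
    have h3 : p ∣ Nat.card P := P.dvd_card_of_dvd_card hpd
    have h4 : p ≤ Nat.card P := Nat.le_of_dvd Nat.card_pos h3
    have h5 := hpp.two_le
    have h6 : 0 < Nat.card (G ⧸ (P : Subgroup G)) := Nat.card_pos
    have h7 : 2 ≤ Nat.card (P : Subgroup G) := h5.trans h4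
    nlinarith
  · have h := (ht _ (Nat.mem_divisors.2 ⟨hdiv, by omega⟩) hmod).resolve_left hsub
    let f := MulAction.toPermHom G (Sylow p G)
    have hr : Nat.card f.range ∣ (Nat.card (Sylow p G)).factorial := by
      rw [← Nat.card_perm]; exact Subgroup.card_subgroup_dvd_card _
    have hk : Nat.card f.ker * Nat.card f.range = Nat.card G := by
      rw [← Subgroup.index_ker]; exact Subgroup.card_mul_index _
    have hrlt : Nat.card f.range < Nat.card G :=
      (Nat.le_of_dvd (Nat.factorial_pos _) hr).trans_lt h
    have hr2 : Nat.card f.range ≠ 1 := by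
      intro h1
      have h2 := Subgroup.card_eq_one.1 h1
      apply hsub
      rw [Nat.card_eq_one_iff_unique]
      refine ⟨⟨fun Q R => ?_⟩, ⟨P⟩⟩
      obtain ⟨g, rfl⟩ := MulAction.exists_smul_eq G Q R
      have : f g = 1 := by
        have : f g ∈ f.range := ⟨g, rfl⟩
        rwa [h2, Subgroup.mem_bot] at this
      exact (congrArg (fun e : Equiv.Perm (Sylow p G) => e Q) this).symm
    have hk0 : 0 < Nat.card f.ker := Nat.card_pos
    have hr0 : 0 < Nat.card f.range := Nat.card_pos
    refine f.isSolvable_of_ker_range (key _ ⟨_, hk.symm⟩ ?_)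
      (key _ ⟨_, by rw [mul_comm]; exact hk.symm⟩ hrlt)
    have : 2 ≤ Nat.card f.range := by omega
    nlinarith

/-- Burnside transfer at a prime dividing the order of a cyclic core-free maximal subgroup. -/
theorem Subgroup.not_dvd_card_commutator_of_isCoatom {G : Type*} [Group G] [Finite G]
    {A : Subgroup G} [hcyc : IsCyclic A] (hA : IsCoatom A) (hcore : A.normalCore = ⊥)
    {p : ℕ} (hp : p.Prime) (hpA : p ∣ Nat.card A) : ¬ p ∣ Nat.card (_root_.commutator G) := by
  have : Fact p.Prime := ⟨hp⟩
  have hcomm : ∀ x ∈ A, ∀ y ∈ A, x * y = y * x := by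
    intro x hx y hy
    have := hcyc.isMulCommutative.is_comm.comm ⟨x, hx⟩ ⟨y, hy⟩
    exact congrArg Subtype.val this
  obtain ⟨Q⟩ : Nonempty (Sylow p A) := inferInstance
  set P₀ : Subgroup G := (Q : Subgroup A).map A.subtype with hP₀
  have hP₀A : P₀ ≤ A := Subgroup.map_subtype_le _
  have hP₀p : IsPGroup p P₀ := Q.isPGroup'.map _
  have hle : A ≤ Subgroup.normalizer (P₀ : Set G) := by
    intro a ha
    rw [Subgroup.mem_normalizer_iff]
    intro x
    have hconj : ∀ y ∈ P₀, ∀ b ∈ A, b * y * b⁻¹ = y := fun y hy b hb => by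
      rw [hcomm b hb y (hP₀A hy), mul_inv_cancel_right]
    constructor
    · intro hx
      rwa [hconj x hx a ha]
    · intro hx
      have := hconj _ hx a⁻¹ (A.inv_mem ha)
      rw [show a⁻¹ * (a * x * a⁻¹) * a⁻¹⁻¹ = x by group] at this
      rwa [this]
  have hP₀ne : P₀ ≠ ⊥ := by
    intro h
    rw [hP₀, Subgroup.map_eq_bot_iff_of_injective _ A.subtype_injective] at h
    exact Q.ne_bot_of_dvd_card hpA h
  have hnorm : Subgroup.normalizer (P₀ : Set G) = A := by
    refine (hA.le_iff.1 hle).resolve_left fun h => hP₀ne ?_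
    have hN : P₀.Normal := Subgroup.normalizer_eq_top_iff.1 h
    rw [eq_bot_iff, ← hcore]
    exact Subgroup.normal_le_normalCore.2 hP₀A
  obtain ⟨P, hP⟩ := hP₀p.exists_le_sylow
  have hPA : (P : Subgroup G) ⊓ A ≤ P₀ := by
    have h1 : IsPGroup p (((P : Subgroup G) ⊓ A).subgroupOf A) :=
      (P.isPGroup'.to_le inf_le_left).comap_subtype
    have h2 : (Q : Subgroup A) ≤ ((P : Subgroup G) ⊓ A).subgroupOf A := by
      intro x hx
      have : (x : G) ∈ P₀ := Subgroup.mem_map_of_mem A.subtype hx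
      exact Subgroup.mem_subgroupOf.2 ⟨hP this, x.2⟩
    have h3 := Q.is_maximal' h1 h2
    intro x hx
    have : (⟨x, hx.2⟩ : A) ∈ (Q : Subgroup A) := by
      rw [← h3]; exact Subgroup.mem_subgroupOf.2 hx
    exact Subgroup.mem_map_of_mem A.subtype this
  have hPeq : (P : Subgroup G) = P₀ := by
    refine le_antisymm ?_ hP
    by_contra hlt
    have hnil := P.isPGroup'.isNilpotent
    have h1 : P₀.subgroupOf P < ⊤ := by
      rw [lt_top_iff_ne_top]
      exact fun h => hlt (Subgroup.subgroupOf_eq_top.1 h)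
    obtain ⟨g, hg1, hg2⟩ := SetLike.exists_of_lt (Group.normalizerCondition_of_isNilpotent _ h1)
    apply hg2
    rw [Subgroup.mem_subgroupOf]
    refine hPA ⟨g.2, ?_⟩
    rw [← hnorm]
    refine Subgroup.mem_normalizer_iff.2 ?_
    rw [Subgroup.mem_normalizer_iff] at hg1
    intro x
    by_cases hx : x ∈ P
    · exact hg1 ⟨x, hx⟩
    · refine ⟨fun h => absurd (hP h) hx, fun h => absurd ?_ hx⟩
      have h4 := P.mul_mem (P.mul_mem (P.inv_mem g.2) (hP h)) g.2
      have h5 : (g : G)⁻¹ * (g * x * (g : G)⁻¹) * g = x := by group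
      rwa [h5] at h4
  have hPle : Subgroup.normalizer (P : Set G) ≤ Subgroup.centralizer (P : Set G) := by
    have : (P : Set G) = (P₀ : Set G) := by rw [← hPeq]; rfl
    rw [this, hnorm]
    intro a ha
    rw [Subgroup.mem_centralizer_iff]
    exact fun y hy => hcomm y (hP₀A hy) a ha
  have hker := MonoidHom.not_dvd_card_ker_transferSylow P hPle
  refine fun hd => hker (hd.trans (Subgroup.card_dvd_of_le ?_))
  rw [_root_.commutator_def, Subgroup.commutator_le]
  intro x _ y _
  rw [MonoidHom.mem_ker, map_commutatorElement, commutatorElement_eq_one_iff_mul_comm]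
  apply Subtype.ext
  have hin : ∀ z : P, (z : G) ∈ A := fun z => by
    have : (z : G) ∈ (P : Subgroup G) := z.2
    rw [hPeq] at this
    exact hP₀A this
  exact hcomm _ (hin _) _ (hin _)

theorem Group.isSolvable_of_isCoatom_of_normalCore_eq_bot {G : Type*} [Group G] [Finite G]
    {A : Subgroup G} [IsCyclic A] (hA : IsCoatom A) (hcore : A.normalCore = ⊥)
    (hd : A.index ≤ 13) : Group.IsSolvable G := by
  have hco : (Nat.card (_root_.commutator G)).Coprime (Nat.card A) :=
    Nat.coprime_of_dvd fun p hp h1 h2 =>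
      Subgroup.not_dvd_card_commutator_of_isCoatom hA hcore hp h2 h1
  rw [Group.isSolvable_iff_subgroup_quotient (commutator G)]
  have hle : Nat.card (_root_.commutator G) ≤ 13 := by
    refine (Nat.le_of_dvd (Nat.pos_of_ne_zero A.index_ne_zero_of_finite) ?_).trans hd
    refine hco.dvd_of_dvd_mul_left ?_
    rw [A.card_mul_index]
    exact Subgroup.card_subgroup_dvd_card _
  refine ⟨Group.isSolvable_of_card_le (by omega) (by omega) (by omega), ?_⟩
  exact inferInstanceAs (Group.IsSolvable (Abelianization G))

/-- A finite group with a cyclic maximal subgroup of small index is solvable. -/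
theorem Group.isSolvable_of_isCoatom_isCyclic {G : Type*} [Group G] [Finite G]
    {A : Subgroup G} [IsCyclic A] (hA : IsCoatom A) (hd : A.index ≤ 13) : Group.IsSolvable G := by
  set K := A.normalCore
  have hKA : K ≤ A := A.normalCore_le
  have hK : Group.IsSolvable K :=
    Group.isSolvable_of_isSolvable_injective (Subgroup.inclusion_injective hKA)
  rw [Group.isSolvable_iff_subgroup_quotient K]
  refine ⟨hK, ?_⟩
  let π := QuotientGroup.mk' K
  have hπ : Function.Surjective π := QuotientGroup.mk'_surjective K
  have hker : π.ker ≤ A := by rw [QuotientGroup.ker_mk']; exact hKA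
  have hcm : (A.map π).comap π = A := by rw [Subgroup.comap_map_eq, sup_eq_left.2 hker]
  have : IsCyclic (A.map π) := isCyclic_of_surjective _ (π.subgroupMap_surjective A)
  refine Group.isSolvable_of_isCoatom_of_normalCore_eq_bot (A := A.map π) ⟨?_, ?_⟩ ?_ ?_
  · intro h
    rw [h, Subgroup.comap_top] at hcm
    exact hA.1 hcm.symm
  · intro B hB
    have h1 : A < B.comap π :=
      hcm.symm.trans_lt ((Subgroup.comap_lt_comap_of_surjective hπ).2 hB)
    have h2 := hA.2 _ h1
    rw [← Subgroup.map_comap_eq_self_of_surjective hπ B, h2, Subgroup.map_top_of_surjective _ hπ]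
  · rw [← Subgroup.map_comap_eq_self_of_surjective hπ (A.map π).normalCore,
      Subgroup.map_eq_bot_iff, QuotientGroup.ker_mk']
    refine Subgroup.normal_le_normalCore.2 ?_
    exact (Subgroup.comap_mono (Subgroup.normalCore_le _)).trans_eq hcm
  · rwa [Subgroup.index_map_eq _ hπ hker]

theorem Equiv.Perm.pow_eq_one_or_sign_eq_neg_one_of_fin_five : ∀ σ : Equiv.Perm (Fin 5),
    σ ^ 4 = 1 ∨ σ ^ 5 = 1 ∨ σ ^ 3 = 1 ∨ (σ ^ 6 = 1 ∧ σ.sign = -1) := by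
  decide +kernel

theorem Equiv.Perm.pow_eq_one_of_fin_six : ∀ σ : Equiv.Perm (Fin 6),
    σ ^ 4 = 1 ∨ σ ^ 5 = 1 ∨ σ ^ 6 = 1 := by
  decide +kernel

theorem Equiv.Perm.orderOf_le_six_of_fin_six (σ : Equiv.Perm (Fin 6)) : orderOf σ ≤ 6 := by
  rcases Equiv.Perm.pow_eq_one_of_fin_six σ with h | h | h
  · exact (orderOf_le_of_pow_eq_one (by norm_num) h).trans (by norm_num)
  · exact (orderOf_le_of_pow_eq_one (by norm_num) h).trans (by norm_num)
  · exact orderOf_le_of_pow_eq_one (by norm_num) h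

/-- Subgroups of `S₅` having a cyclic subgroup of index at most `10` are solvable. -/
theorem Equiv.Perm.isSolvable_of_card_le_of_fin_five {H : Subgroup (Equiv.Perm (Fin 5))}
    {σ : Equiv.Perm (Fin 5)} (hσ : σ ∈ H) (h : Nat.card H ≤ 10 * orderOf σ) :
    Group.IsSolvable H := by
  have hd : Nat.card H ∣ 120 := by
    have := Subgroup.card_subgroup_dvd_card H
    rwa [Nat.card_perm, Nat.card_fin] at this
  have h5 : orderOf σ ≤ 5 ∨ (orderOf σ ≤ 6 ∧ σ.sign = -1) := by
    rcases pow_eq_one_or_sign_eq_neg_one_of_fin_five σ with h | h | h | ⟨h, hs⟩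
    · exact .inl ((orderOf_le_of_pow_eq_one (by norm_num) h).trans (by norm_num))
    · exact .inl (orderOf_le_of_pow_eq_one (by norm_num) h)
    · exact .inl ((orderOf_le_of_pow_eq_one (by norm_num) h).trans (by norm_num))
    · exact .inr ⟨orderOf_le_of_pow_eq_one (by norm_num) h, hs⟩
  refine Group.isSolvable_of_card_le (by omega) (fun h56 => by rw [h56] at hd; omega) fun h60 => ?_
  obtain ⟨-, hs⟩ := h5.resolve_left (by omega)
  have hi : H.index = 2 := by
    have := H.card_mul_index
    rw [Nat.card_perm, Nat.card_fin, h60, show Nat.factorial 5 = 120 from rfl] at this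
    omega
  rw [eq_alternatingGroup_of_index_eq_two hi, mem_alternatingGroup, hs] at hσ
  exact absurd hσ (by decide)

theorem Subgroup.exists_hom_perm_fin {G : Type*} [Group G] [Finite G] (M : Subgroup G) {j : ℕ}
    (hj : M.index = j) : ∃ f : G →* Equiv.Perm (Fin j), f.ker = M.normalCore := by
  let e : G ⧸ M ≃ Fin j := Finite.equivFinOfCardEq hj
  refine ⟨e.permCongrHom.toMonoidHom.comp (MulAction.toPermHom G (G ⧸ M)), ?_⟩
  rw [Subgroup.normalCore_eq_ker]
  ext g
  simp [MonoidHom.mem_ker]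

theorem MonoidHom.card_range_le_index_zpowers_mul {G H : Type*} [Group G] [Finite G] [Group H]
    (f : G →* H) (a : G) :
    Nat.card f.range ≤ (Subgroup.zpowers a).index * orderOf (f a) := by
  set B := (Subgroup.zpowers a).map f.rangeRestrict with hB
  have h1 : Nat.card B = orderOf (f a) := by
    rw [hB, MonoidHom.map_zpowers, Nat.card_zpowers, ← Subgroup.orderOf_coe]
    rfl
  have h2 : B.index ∣ (Subgroup.zpowers a).index :=
    Subgroup.index_map_dvd _ f.rangeRestrict_surjective
  rw [← B.card_mul_index, h1, mul_comm]
  exact Nat.mul_le_mul_right _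
    (Nat.le_of_dvd (Nat.pos_of_ne_zero Subgroup.index_ne_zero_of_finite) h2)

theorem Group.isSolvable_of_index_le_four {G : Type*} [Group G] [Finite G] {M : Subgroup G}
    (hM : Group.IsSolvable M) (h4 : M.index ≤ 4) : Group.IsSolvable G := by
  obtain ⟨f, hf⟩ := M.exists_hom_perm_fin rfl
  refine f.isSolvable_of_ker_range ?_ ?_
  · exact Group.isSolvable_of_isSolvable_injective
      (Subgroup.inclusion_injective (hf.le.trans M.normalCore_le))
  · have h1 : Nat.card f.range ≤ 24 := by
      refine (Nat.le_of_dvd (Nat.factorial_pos _)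
        (Subgroup.card_subgroup_dvd_card f.range |>.trans ?_)).trans
          (Nat.factorial_le h4)
      rw [Nat.card_perm, Nat.card_fin]
    exact Group.isSolvable_of_card_le (by omega) (by omega) (by omega)

/-- Either `zpowers a` is everything or maximal, and the group is solvable, or there is a subgroup
strictly between; its generator and index are recorded. -/
theorem Subgroup.isSolvable_or_exists_between {G : Type*} [Group G] [Finite G] {a : G}
    (ha : (Subgroup.zpowers a).index ≤ 13) :
    Group.IsSolvable G ∨ ∃ (M : Subgroup G) (b : M), Subgroup.zpowers a ≤ M ∧
      (Subgroup.zpowers b).index = (Subgroup.zpowers a).relIndex M ∧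
      (Subgroup.zpowers a).relIndex M * M.index = (Subgroup.zpowers a).index ∧
      2 ≤ (Subgroup.zpowers a).relIndex M ∧ 2 ≤ M.index := by
  rcases eq_or_ne (Subgroup.zpowers a) ⊤ with htop | htop
  · left
    have : IsCyclic (⊤ : Subgroup G) := by rw [← htop]; infer_instance
    exact Group.isSolvable_of_isSolvable_injective
      (f := (Subgroup.topEquiv (G := G)).symm.toMonoidHom) (MulEquiv.injective _)
  by_cases hco : IsCoatom (Subgroup.zpowers a)
  · exact .inl (Group.isSolvable_of_isCoatom_isCyclic hco ha)
  right
  simp only [IsCoatom, not_and, not_forall] at hco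
  obtain ⟨M, hM, hMt⟩ := hco htop
  have haM : a ∈ M := hM.le (Subgroup.mem_zpowers a)
  have hz : Subgroup.zpowers (⟨a, haM⟩ : M) = (Subgroup.zpowers a).subgroupOf M := by
    apply Subgroup.map_injective M.subtype_injective
    rw [MonoidHom.map_zpowers, Subgroup.subgroupOf_map_subtype, inf_eq_left.2 hM.le]
    rfl
  refine ⟨M, ⟨a, haM⟩, hM.le, by rw [hz]; rfl, Subgroup.relIndex_mul_index hM.le, ?_, ?_⟩
  · have h0 : (Subgroup.zpowers a).relIndex M ≠ 0 := Subgroup.index_ne_zero_of_finite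
    have h1 : (Subgroup.zpowers a).relIndex M ≠ 1 := fun h =>
      hM.not_ge (Subgroup.relIndex_eq_one.1 h)
    omega
  · have h0 : M.index ≠ 0 := Subgroup.index_ne_zero_of_finite
    have h1 : M.index ≠ 1 := fun h => hMt (Subgroup.index_eq_one.1 h)
    omega

theorem Group.isSolvable_of_index_zpowers_le_ten {G : Type*} [Group G] [Finite G] {a : G}
    (ha : (Subgroup.zpowers a).index ≤ 10) : Group.IsSolvable G := by
  induction hN : (Subgroup.zpowers a).index using Nat.strong_induction_on generalizing G with
  | _ n ih =>
  subst hN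
  rcases Subgroup.isSolvable_or_exists_between (a := a) (by omega) with
    h | ⟨M, b, -, hb, hm, hi, hj⟩
  · exact h
  have hlt : (Subgroup.zpowers b).index < (Subgroup.zpowers a).index := by rw [hb]; nlinarith
  have hMs : Group.IsSolvable M := ih _ hlt (by omega) rfl
  have hj5 : M.index ≤ 5 := by nlinarith
  rcases hj5.lt_or_eq with h4 | h5
  · exact Group.isSolvable_of_index_le_four hMs (by omega)
  obtain ⟨f, hf⟩ := M.exists_hom_perm_fin h5
  refine f.isSolvable_of_ker_range (Group.isSolvable_of_isSolvable_injective
      (Subgroup.inclusion_injective (hf.le.trans M.normalCore_le))) ?_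
  exact Equiv.Perm.isSolvable_of_card_le_of_fin_five (σ := f a) ⟨a, rfl⟩
    ((f.card_range_le_index_zpowers_mul a).trans (Nat.mul_le_mul_right _ ha))

/-- A nonsolvable group with a cyclic subgroup of index at most `13` has a normal subgroup of
index `60` inside it. -/
theorem Subgroup.exists_normal_index_eq_sixty {G : Type*} [Group G] [Finite G] {a : G}
    (hG : ¬ Group.IsSolvable G) (ha : (Subgroup.zpowers a).index ≤ 13) :
    ∃ N : Subgroup G, N.Normal ∧ N ≤ Subgroup.zpowers a ∧ N.index = 60 := by
  have h10 : ¬ (Subgroup.zpowers a).index ≤ 10 := fun h =>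
    hG (Group.isSolvable_of_index_zpowers_le_ten h)
  obtain ⟨M, b, haM, hb, hm, hi, hj⟩ := (Subgroup.isSolvable_or_exists_between ha).resolve_left hG
  have hMs : Group.IsSolvable M :=
    Group.isSolvable_of_index_zpowers_le_ten (a := b) (by rw [hb]; nlinarith)
  have hj4 : ¬ M.index ≤ 4 := fun h => hG (Group.isSolvable_of_index_le_four hMs h)
  have hi2 : (Subgroup.zpowers a).relIndex M = 2 := by
    by_contra h
    have : 3 ≤ (Subgroup.zpowers a).relIndex M := by omega
    nlinarith
  rw [hi2] at hm
  have hj6 : M.index = 6 := by omega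
  obtain ⟨f, hf⟩ := M.exists_hom_perm_fin hj6
  have hNM : f.ker ≤ M := hf.le.trans M.normalCore_le
  have hH : ¬ Group.IsSolvable f.range := fun h => hG (f.isSolvable_of_ker_range
    (Group.isSolvable_of_isSolvable_injective (Subgroup.inclusion_injective hNM)) h)
  have hcard := f.card_range_le_index_zpowers_mul a
  have ho := (f a).orderOf_le_six_of_fin_six
  have hd : Nat.card f.range ∣ 720 := by
    have := Subgroup.card_subgroup_dvd_card f.range
    rwa [Nat.card_perm, Nat.card_fin] at this
  have h60 : Nat.card f.range = 60 := by
    by_contra h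
    refine hH (Group.isSolvable_of_card_le ?_ (fun h56 => by rw [h56] at hd; omega) h)
    nlinarith
  have hk : f.ker.index = 60 := by rw [Subgroup.index_ker, h60]
  refine ⟨f.ker, inferInstance, ?_, hk⟩
  have hr := Subgroup.relIndex_mul_index hNM
  have hle : Subgroup.zpowers a ⊔ f.ker ≤ M := sup_le haM hNM
  have hs := Subgroup.relIndex_mul_relIndex _ _ _ (le_sup_left : Subgroup.zpowers a ≤ _ ⊔ f.ker) hle
  rw [hi2] at hs
  have h12 : (Subgroup.zpowers a).relIndex (Subgroup.zpowers a ⊔ f.ker) = 1 ∨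
      (Subgroup.zpowers a).relIndex (Subgroup.zpowers a ⊔ f.ker) = 2 :=
    (Nat.dvd_prime Nat.prime_two).1 ⟨_, hs.symm⟩
  rcases h12 with h1 | h2
  · exact le_sup_right.trans (Subgroup.relIndex_eq_one.1 h1)
  exfalso
  have hMe : (Subgroup.zpowers a ⊔ f.ker).relIndex M = 1 := by rw [h2] at hs; omega
  have hMeq : M = Subgroup.zpowers a ⊔ f.ker := le_antisymm (Subgroup.relIndex_eq_one.1 hMe) hle
  have h3 : f.ker.relIndex M = orderOf (f a) := by
    rw [Subgroup.relIndex_ker, hMeq, Subgroup.map_sup, (Subgroup.map_eq_bot_iff _).2 le_rfl,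
      sup_bot_eq, MonoidHom.map_zpowers, Nat.card_zpowers]
  rw [h3, hk, hj6] at hr
  omega

section OrderSixty

variable {Q : Type*} [Group Q] [Finite Q]

theorem Subgroup.eq_bot_or_eq_top_of_card_eq_sixty (hQ : Nat.card Q = 60)
    (hns : ¬ Group.IsSolvable Q) (L : Subgroup Q) [L.Normal] : L = ⊥ ∨ L = ⊤ := by
  by_contra! h
  have h1 := L.card_mul_index
  rw [hQ] at h1
  have h2 : Nat.card L ≠ 1 := fun h' => h.1 (Subgroup.card_eq_one.1 h')
  have h3 : L.index ≠ 1 := fun h' => h.2 (Subgroup.index_eq_one.1 h')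
  have h4 : Nat.card L ≠ 0 := Nat.card_pos.ne'
  have h5 : L.index ≠ 0 := Subgroup.index_ne_zero_of_finite
  have h6 : Nat.card L < 60 := by
    have : 2 ≤ L.index := by omega
    have : 0 < Nat.card L := by omega
    nlinarith
  have h7 : L.index < 60 := by
    have : 2 ≤ Nat.card L := by omega
    have : 0 < L.index := by omega
    nlinarith
  have h8 : Nat.card L ≠ 56 := fun h' => by rw [h'] at h1; omega
  have h9 : L.index ≠ 56 := fun h' => by rw [h'] at h1; omega
  refine hns ((Group.isSolvable_iff_subgroup_quotient L).2
    ⟨Group.isSolvable_of_card_le (by omega) h8 (by omega), ?_⟩)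
  rw [Subgroup.index] at h7 h9
  exact Group.isSolvable_of_card_le (by omega) h9 (by omega)

theorem orderOf_mem_of_card_eq_sixty (hQ : Nat.card Q = 60) (hns : ¬ Group.IsSolvable Q) (q : Q) :
    orderOf q = 1 ∨ orderOf q = 2 ∨ orderOf q = 3 ∨ orderOf q = 5 := by
  have h1 := (Subgroup.zpowers q).card_mul_index
  rw [hQ, Nat.card_zpowers] at h1
  have h2 : 10 < (Subgroup.zpowers q).index := by
    by_contra! h
    exact hns (Group.isSolvable_of_index_zpowers_le_ten h)
  have h3 : orderOf q < 6 := by nlinarith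
  have h4 : 0 < orderOf q := orderOf_pos q
  have h5 : orderOf q ≠ 4 := by
    intro h
    have : Fact (Nat.Prime 2) := ⟨Nat.prime_two⟩
    have hf : Nat.factorization 60 2 = 2 := by
      rw [← Nat.primeFactorsList_count_eq]
      decide +kernel
    let P : Sylow 2 Q := Sylow.ofCard (Subgroup.zpowers q) (by
      rw [Nat.card_zpowers, h, hQ, hf]; rfl)
    have hP : IsCyclic P := inferInstanceAs (IsCyclic (Subgroup.zpowers q))
    have hm : (Nat.card Q).minFac = 2 := by rw [hQ]; norm_num
    have hc := IsCyclic.isComplement' hm hP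
    have hc1 := hc.card_mul_card
    have hcP : Nat.card P = 4 := by
      rw [← h, ← Nat.card_zpowers]; rfl
    rw [hcP, hQ] at hc1
    rcases Subgroup.eq_bot_or_eq_top_of_card_eq_sixty hQ hns
      (MonoidHom.transferSylow P (hP.normalizer_le_centralizer hm)).ker with h' | h'
    · rw [h', Subgroup.card_bot] at hc1; omega
    · rw [h', Subgroup.card_top, hQ] at hc1; omega
  interval_cases orderOf q <;> simp_all

/-- Elements of order `p` are covered by the Sylow subgroups when these have order `p`. -/
theorem card_orderOf_eq_le_card_sylow_mul {Q : Type*} [Group Q] [Fintype Q] {p : ℕ} [Fact p.Prime]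
    (hp : ∀ P : Sylow p Q, Nat.card P = p) :
    (Finset.univ.filter fun q : Q => orderOf q = p).card ≤ Nat.card (Sylow p Q) * (p - 1) := by
  classical
  have := Fintype.ofFinite (Sylow p Q)
  have hsub : (Finset.univ.filter fun q : Q => orderOf q = p) ⊆
      (Finset.univ : Finset (Sylow p Q)).biUnion fun P =>
        (Finset.univ.filter fun q : Q => q ∈ P).erase 1 := by
    intro q hq
    have hq' : orderOf q = p := (Finset.mem_filter.1 hq).2
    have hz : IsPGroup p (Subgroup.zpowers q) :=
      IsPGroup.of_card (n := 1) (by rw [Nat.card_zpowers, hq', pow_one])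
    obtain ⟨P, hP⟩ := hz.exists_le_sylow
    refine Finset.mem_biUnion.2 ⟨P, Finset.mem_univ _, Finset.mem_erase.2 ⟨?_, ?_⟩⟩
    · rintro rfl
      rw [orderOf_one] at hq'
      exact (Fact.out : p.Prime).one_lt.ne hq'
    · exact Finset.mem_filter.2 ⟨Finset.mem_univ _, hP (Subgroup.mem_zpowers q)⟩
  refine (Finset.card_le_card hsub).trans ((Finset.card_biUnion_le_card_mul _ _ (p - 1) ?_).trans ?_)
  · intro P _
    rw [Finset.card_erase_of_mem (by simp)]
    have h : (Finset.univ.filter fun q : Q => q ∈ P).card = Nat.card P := by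
      rw [Nat.card_eq_fintype_card]
      exact (Fintype.card_subtype _).symm
    rw [h, hp P]
  · rw [Finset.card_univ, Nat.card_eq_fintype_card]

theorem Sylow.card_eq_of_card_eq_sixty (hQ : Nat.card Q = 60) {p : ℕ} [Fact p.Prime]
    (hp : p = 3 ∨ p = 5) (P : Sylow p Q) : Nat.card P = p := by
  have h3 : Nat.factorization 60 3 = 1 := by
    rw [← Nat.primeFactorsList_count_eq]
    decide +kernel
  have h5 : Nat.factorization 60 5 = 1 := by
    rw [← Nat.primeFactorsList_count_eq]
    decide +kernel
  rw [P.card_eq_multiplicity, hQ]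
  rcases hp with rfl | rfl
  · rw [h3]; rfl
  · rw [h5]; rfl

theorem card_orderOf_le_of_card_eq_sixty [Fintype Q] (hQ : Nat.card Q = 60) {p b : ℕ}
    (hp : p.Prime) (hp' : p = 3 ∨ p = 5)
    (hb : ∀ t ∈ (60 / p).divisors, t % p = 1 → t * (p - 1) ≤ b) :
    (Finset.univ.filter fun q : Q => orderOf q = p).card ≤ b := by
  have : Fact p.Prime := ⟨hp⟩
  have hP := Sylow.card_eq_of_card_eq_sixty hQ hp'
  refine (card_orderOf_eq_le_card_sylow_mul hP).trans (hb _ ?_ ?_)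
  · obtain ⟨P⟩ : Nonempty (Sylow p Q) := inferInstance
    have h1 := (P : Subgroup Q).card_mul_index
    have h2 : (P : Subgroup Q).index = 60 / p := by
      rw [← hQ, ← h1, hP P, Nat.mul_div_cancel_left _ hp.pos]
    rw [Nat.mem_divisors, ← h2]
    exact ⟨P.card_dvd_index, Subgroup.index_ne_zero_of_finite⟩
  · have := card_sylow_modEq_one p Q
    rwa [Nat.ModEq, Nat.mod_eq_of_lt hp.one_lt] at this

/-- In a nonsolvable group of order `60`, sums of increasing weights of the element orders are
bounded by the value for `A₅`. -/
theorem sum_weight_orderOf_le_of_card_eq_sixty [Fintype Q] (hQ : Nat.card Q = 60)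
    (hns : ¬ Group.IsSolvable Q) (w : ℕ → ℚ) (h23 : w 2 ≤ w 3) (h25 : w 2 ≤ w 5) :
    ∑ q : Q, w (orderOf q) ≤ w 1 + 15 * w 2 + 20 * w 3 + 24 * w 5 := by
  classical
  let c : ℕ → ℕ := fun r => (Finset.univ.filter fun q : Q => orderOf q = r).card
  have hmaps : ∀ q ∈ (Finset.univ : Finset Q), orderOf q ∈ ({1, 2, 3, 5} : Finset ℕ) := by
    intro q _
    simpa using orderOf_mem_of_card_eq_sixty hQ hns q
  have hc1 : c 1 = 1 := by
    simp only [c, orderOf_eq_one_iff]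
    rw [Finset.filter_eq' Finset.univ (1 : Q)]
    simp
  have hc3 : c 3 ≤ 20 :=
    card_orderOf_le_of_card_eq_sixty hQ Nat.prime_three (.inl rfl) (by decide +kernel)
  have hc5 : c 5 ≤ 24 :=
    card_orderOf_le_of_card_eq_sixty hQ Nat.prime_five (.inr rfl) (by decide +kernel)
  have hsum : c 1 + (c 2 + (c 3 + c 5)) = 60 := by
    have := Finset.card_eq_sum_card_fiberwise hmaps
    rw [Finset.card_univ, ← Nat.card_eq_fintype_card, hQ] at this
    rw [this]
    simp [c]
  have hw : ∑ q : Q, w (orderOf q) = c 1 * w 1 + (c 2 * w 2 + (c 3 * w 3 + c 5 * w 5)) := by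
    rw [← Finset.sum_fiberwise_of_maps_to hmaps]
    have : ∀ r, ∑ q : Q with orderOf q = r, w (orderOf q) = c r * w r := by
      intro r
      rw [Finset.sum_congr rfl fun q hq => by rw [(Finset.mem_filter.1 hq).2], Finset.sum_const,
        nsmul_eq_mul]
    simp [this]
  rw [hw, hc1]
  have hc2 : (c 2 : ℚ) = 59 - c 3 - c 5 := by
    have : ((c 1 + (c 2 + (c 3 + c 5)) : ℕ) : ℚ) = 60 := by rw [hsum]; norm_num
    push_cast [hc1] at this
    linarith
  have hc3' : (c 3 : ℚ) ≤ 20 := by exact_mod_cast hc3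
  have hc5' : (c 5 : ℚ) ≤ 24 := by exact_mod_cast hc5
  rw [hc2]
  push_cast
  nlinarith [mul_nonneg (sub_nonneg.2 hc3') (sub_nonneg.2 h23),
    mul_nonneg (sub_nonneg.2 hc5') (sub_nonneg.2 h25)]

end OrderSixty

section CyclicPsi

open Nat

/-- The sum of the `k`-th powers of the element orders in a cyclic group of order `m`. -/
def cyclicPsi (k m : ℕ) : ℕ :=
  ∑ d ∈ m.divisors, φ d * d ^ k

theorem sum_orderOf_pow_eq_cyclicPsi {H : Type*} [Group H] [IsCyclic H] [Fintype H] (k : ℕ) :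
    ∑ x : H, orderOf x ^ k = cyclicPsi k (Nat.card H) := by
  have hmaps : ∀ x ∈ (Finset.univ : Finset H), orderOf x ∈ (Nat.card H).divisors := fun x _ =>
    Nat.mem_divisors.2 ⟨orderOf_dvd_natCard x, Nat.card_pos.ne'⟩
  rw [← Finset.sum_fiberwise_of_maps_to hmaps]
  refine Finset.sum_congr rfl fun d hd => ?_
  rw [Finset.sum_congr rfl fun x hx => by rw [(Finset.mem_filter.1 hx).2], Finset.sum_const,
    smul_eq_mul, IsCyclic.card_orderOf_eq_totient]
  rw [← Nat.card_eq_fintype_card]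
  exact Nat.dvd_of_mem_divisors hd

variable (k : ℕ)

theorem cyclicPsi_mul {a b : ℕ} (h : a.Coprime b) :
    cyclicPsi k (a * b) = cyclicPsi k a * cyclicPsi k b := by
  let f : ArithmeticFunction ℕ := ⟨fun d => φ d * d ^ k, by simp⟩
  have hf : f.IsMultiplicative := ⟨by simp [f], fun {m n} hmn => by
    simp only [f, ArithmeticFunction.coe_mk, Nat.totient_mul hmn, mul_pow]
    ring⟩
  have := (hf.mul ArithmeticFunction.isMultiplicative_zeta).map_mul_of_coprime h
  simp only [ArithmeticFunction.mul_zeta_apply] at this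
  exact this

theorem totient_mul_pow_le_cyclicPsi {m : ℕ} (hm : m ≠ 0) : φ m * m ^ k ≤ cyclicPsi k m :=
  Finset.single_le_sum (f := fun d => φ d * d ^ k) (fun _ _ => Nat.zero_le _)
    (Nat.mem_divisors_self m hm)

variable {p : ℕ}

theorem cyclicPsi_prime_pow_succ (hp : p.Prime) (e : ℕ) :
    cyclicPsi k (p ^ (e + 1)) = cyclicPsi k (p ^ e) + p ^ e * (p - 1) * (p ^ (e + 1)) ^ k := by
  rw [cyclicPsi, cyclicPsi, Nat.sum_divisors_prime_pow hp, Nat.sum_divisors_prime_pow hp,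
    Finset.sum_range_succ, Nat.totient_prime_pow_succ hp]

theorem cyclicPsi_prime (hp : p.Prime) : cyclicPsi k p = 1 + (p - 1) * p ^ k := by
  have h := cyclicPsi_prime_pow_succ k hp 0
  have h1 : cyclicPsi k 1 = 1 := by simp [cyclicPsi]
  simpa [h1] using h

theorem cyclicPsi_prime_pow_succ_add (hp : p.Prime) (e : ℕ) :
    cyclicPsi k (p ^ (e + 1)) + p ^ k = p ^ (k + 1) * cyclicPsi k (p ^ e) + 1 := by
  obtain ⟨q, rfl⟩ : ∃ q, p = q + 1 := ⟨p - 1, by have := hp.pos; omega⟩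
  induction e with
  | zero =>
    have h1 : cyclicPsi k 1 = 1 := by simp [cyclicPsi]
    rw [zero_add, pow_one, cyclicPsi_prime k hp, pow_zero, h1, Nat.add_sub_cancel]
    ring
  | succ e ih =>
    rw [cyclicPsi_prime_pow_succ k hp (e + 1)]
    have := cyclicPsi_prime_pow_succ k hp e
    rw [this] at ih ⊢
    rw [Nat.add_sub_cancel] at *
    have e1 : (q + 1) ^ (e + 1) * q * ((q + 1) ^ (e + 1 + 1)) ^ k =
        (q + 1) ^ (k + 1) * ((q + 1) ^ e * q * ((q + 1) ^ (e + 1)) ^ k) := by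
      rw [pow_succ (q + 1) (e + 1), mul_pow]
      ring
    rw [e1, mul_add]
    linarith

theorem cyclicPsi_prime_mul_ge (hp : p.Prime) {u : ℕ} (hu : u ≠ 0) (h : p ∣ u) :
    (p - 1) * p ^ (k + 1) * cyclicPsi k u ≤ (p - 1) * cyclicPsi k (p * u) + cyclicPsi k u := by
  obtain ⟨e, v, hv, rfl⟩ := Nat.exists_eq_pow_mul_and_not_dvd hu p hp.ne_one
  obtain ⟨f, rfl⟩ : ∃ f, e = f + 1 := by
    refine ⟨e - 1, ?_⟩
    have : e ≠ 0 := by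
      rintro rfl
      exact hv (by simpa using h)
    omega
  have hc : ∀ i, (p ^ i).Coprime v := fun i =>
    Nat.Coprime.pow_left i ((Nat.Prime.coprime_iff_not_dvd hp).2 hv)
  rw [← mul_assoc, ← pow_succ', cyclicPsi_mul k (hc _), cyclicPsi_mul k (hc _)]
  have h1 := cyclicPsi_prime_pow_succ_add k hp (f + 1)
  have h2 := cyclicPsi_prime_pow_succ k hp f
  have h3 : (p - 1) * p ^ k ≤ cyclicPsi k (p ^ (f + 1)) := by
    rw [h2]
    refine le_trans ?_ (Nat.le_add_left _ _)
    refine Nat.mul_le_mul (Nat.le_mul_of_pos_left _ (Nat.pow_pos hp.pos)) ?_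
    exact Nat.pow_le_pow_left (Nat.le_self_pow (by omega) p) k
  have h4 : (p - 1) * p ^ (k + 1) * cyclicPsi k (p ^ (f + 1)) ≤
      (p - 1) * cyclicPsi k (p ^ (f + 1 + 1)) + cyclicPsi k (p ^ (f + 1)) := by
    rw [mul_assoc]
    have : (p - 1) * (p ^ (k + 1) * cyclicPsi k (p ^ (f + 1))) ≤
        (p - 1) * (cyclicPsi k (p ^ (f + 1 + 1)) + p ^ k) := Nat.mul_le_mul_left _ (by omega)
    rw [mul_add] at this
    omega
  have h5 := Nat.mul_le_mul_right (cyclicPsi k v) h4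
  linarith

theorem pow_succ_le_cyclicPsi (hp : p.Prime) (e : ℕ) :
    (p - 1) * (p ^ (e + 1)) ^ (k + 1) ≤ p * cyclicPsi k (p ^ (e + 1)) := by
  rw [cyclicPsi_prime_pow_succ k hp, mul_add]
  refine le_of_eq_of_le ?_ (Nat.le_add_left _ _)
  ring

theorem cyclicPsi_four_mul {k u : ℕ} (hk : 3 ≤ k) (hu : u ≠ 0) :
    (if 2 ∣ u then 3 / 2 else 1 : ℚ) * (1 + 2 ^ k + 2 * 4 ^ k) * cyclicPsi k u ≤
      cyclicPsi k (4 * u) := by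
  have h8 : (8 : ℚ) ≤ 2 ^ k := by
    have : (2 : ℚ) ^ 3 ≤ 2 ^ k := pow_le_pow_right₀ (by norm_num) hk
    linarith
  have e4 : (4 : ℚ) ^ k = 2 ^ k * 2 ^ k := by rw [← mul_pow]; norm_num
  split_ifs with h
  · have h1 := cyclicPsi_prime_mul_ge k Nat.prime_two hu h
    have h2 := cyclicPsi_prime_mul_ge k Nat.prime_two (u := 2 * u) (by omega) (by omega)
    rw [← mul_assoc] at h2
    norm_num at h1 h2
    have h1' : (2 ^ (k + 1) * cyclicPsi k u : ℚ) ≤ cyclicPsi k (2 * u) + cyclicPsi k u := by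
      exact_mod_cast h1
    have h2' : (2 ^ (k + 1) * cyclicPsi k (2 * u) : ℚ) ≤
        cyclicPsi k (4 * u) + cyclicPsi k (2 * u) := by exact_mod_cast h2
    rw [pow_succ] at h1' h2'
    rw [e4]
    generalize (2 : ℚ) ^ k = X at *
    have hg : (0 : ℚ) ≤ cyclicPsi k u := Nat.cast_nonneg _
    have h3 : (2 * X - 1) * ((2 * X - 1) * cyclicPsi k u) ≤ (2 * X - 1) * cyclicPsi k (2 * u) :=
      mul_le_mul_of_nonneg_left (by linarith) (by linarith)
    have h4 : 0 ≤ (X * X - 11 / 2 * X - 1 / 2) * cyclicPsi k u :=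
      mul_nonneg (by nlinarith) hg
    nlinarith
  · have h4 : cyclicPsi k 4 = 1 + 2 ^ k + 2 * 4 ^ k := by
      have h := cyclicPsi_prime_pow_succ k Nat.prime_two 1
      have h' := cyclicPsi_prime k Nat.prime_two
      norm_num at h h'
      rw [h, h']
    rw [cyclicPsi_mul k (Nat.Coprime.pow_left 2 ((Nat.Prime.coprime_iff_not_dvd Nat.prime_two).2 h)
      : Nat.Coprime 4 u), h4]
    push_cast
    simp

theorem cyclicPsi_three_mul {k u : ℕ} (hk : 2 ≤ k) (hu : u ≠ 0) :
    (if 3 ∣ u then 4 / 3 else 1 : ℚ) * (1 + 2 * 3 ^ k) * cyclicPsi k u ≤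
      cyclicPsi k (3 * u) := by
  have h9 : (9 : ℚ) ≤ 3 ^ k := by
    have : (3 : ℚ) ^ 2 ≤ 3 ^ k := pow_le_pow_right₀ (by norm_num) hk
    linarith
  split_ifs with h
  · have h1 := cyclicPsi_prime_mul_ge k Nat.prime_three hu h
    norm_num at h1
    have h1' : (2 * 3 ^ (k + 1) * cyclicPsi k u : ℚ) ≤
      2 * cyclicPsi k (3 * u) + cyclicPsi k u := by exact_mod_cast h1
    rw [pow_succ] at h1'
    have hg : (0 : ℚ) ≤ cyclicPsi k u := Nat.cast_nonneg _
    nlinarith [mul_nonneg (sub_nonneg.2 h9) hg]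
  · rw [cyclicPsi_mul k ((Nat.Prime.coprime_iff_not_dvd Nat.prime_three).2 h),
      cyclicPsi_prime k Nat.prime_three]
    norm_num

theorem cyclicPsi_five_mul {k u : ℕ} (hu : u ≠ 0) :
    (if 5 ∣ u then 5 / 4 - 3 / (8 * 5 ^ k) else 1 : ℚ) * (1 + 4 * 5 ^ k) * cyclicPsi k u ≤
      cyclicPsi k (5 * u) := by
  have h0 : (0 : ℚ) < 5 ^ k := by positivity
  split_ifs with h
  · have h1 := cyclicPsi_prime_mul_ge k Nat.prime_five hu h
    norm_num at h1
    have h1' : (4 * 5 ^ (k + 1) * cyclicPsi k u : ℚ) ≤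
      4 * cyclicPsi k (5 * u) + cyclicPsi k u := by exact_mod_cast h1
    rw [pow_succ] at h1'
    have hg : (0 : ℚ) ≤ cyclicPsi k u := Nat.cast_nonneg _
    have e : (5 / 4 - 3 / (8 * 5 ^ k) : ℚ) * (1 + 4 * 5 ^ k) =
        5 * 5 ^ k - 1 / 4 - 3 / (8 * 5 ^ k) := by field_simp; ring
    have h3 : (0 : ℚ) ≤ 3 / (8 * 5 ^ k) := by positivity
    rw [e]
    nlinarith [mul_nonneg h3 hg]
  · rw [cyclicPsi_mul k ((Nat.Prime.coprime_iff_not_dvd Nat.prime_five).2 h),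
      cyclicPsi_prime k Nat.prime_five]
    norm_num

end CyclicPsi

section CosetSum

theorem orderOf_le_mul_orderOf_pow {H : Type*} [Group H] [Finite H] (w : H) {s : ℕ} (hs : 0 < s) :
    orderOf w ≤ s * orderOf (w ^ s) :=
  orderOf_le_of_pow_eq_one (Nat.mul_pos hs (orderOf_pos _)) (by rw [pow_mul, pow_orderOf_eq_one])

theorem sum_orderOf_mul_pow_le_of_isCyclic {H : Type*} [CommGroup H] [Fintype H] [IsCyclic H]
    (k : ℕ) (z : H) {r s t : ℕ} (hH : Nat.card H = s * t) (hrt : r.Coprime t) :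
    ∑ y : H, orderOf (z * y ^ r) ^ k ≤ s ^ (k + 1) * cyclicPsi k t := by
  classical
  have hst0 : 0 < s * t := hH ▸ Nat.card_pos
  have hs : 0 < s := Nat.pos_of_mul_pos_right hst0
  let f : H →* H := powMonoidHom (r * s)
  have hgcd : (Nat.card H).gcd (r * s) = s := by
    rw [hH, mul_comm s t, Nat.gcd_mul_right, (hrt.symm : t.gcd r = 1), one_mul]
  have hcard : Nat.card f.range = t := by
    rw [IsCyclic.card_powMonoidHom_range, hgcd, hH, Nat.mul_div_cancel_left _ hs]
  have hker : Nat.card f.ker = s := by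
    rw [IsCyclic.card_powMonoidHom_ker, hgcd]
  have hindex : f.range.index = s := by
    rw [IsCyclic.index_powMonoidHom_range, hgcd]
  have hz : z ^ s ∈ f.range := by
    have := f.range.pow_index_mem z
    rwa [hindex] at this
  have hfib : ∀ w : f.range, (Finset.univ.filter fun y : H => f.rangeRestrict y = w).card = s := by
    intro w
    rw [MonoidHom.card_fiber_eq_of_mem_range f.rangeRestrict (y := 1)
      (f.rangeRestrict_surjective w) ⟨1, map_one _⟩, ← hker, Nat.card_eq_fintype_card]
    rw [Fintype.card_subtype]
    congr 1
    ext y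
    rw [Finset.mem_filter, Finset.mem_filter, ← MonoidHom.mem_ker, f.ker_rangeRestrict]
  calc ∑ y : H, orderOf (z * y ^ r) ^ k
      ≤ ∑ y : H, s ^ k * orderOf ((⟨z ^ s, hz⟩ : f.range) * f.rangeRestrict y) ^ k := by
        refine Finset.sum_le_sum fun y _ => ?_
        rw [← mul_pow]
        refine Nat.pow_le_pow_left ((orderOf_le_mul_orderOf_pow _ hs).trans_eq ?_) k
        rw [← Subgroup.orderOf_coe, mul_pow, ← pow_mul]
        rfl
    _ = s ^ k * (s * ∑ w : f.range, orderOf ((⟨z ^ s, hz⟩ : f.range) * w) ^ k) := by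
        rw [← Finset.mul_sum]
        congr 1
        rw [Finset.mul_sum]
        refine (Finset.sum_fiberwise Finset.univ (fun y => f.rangeRestrict y) _).symm.trans ?_
        refine Finset.sum_congr rfl fun w _ => ?_
        rw [Finset.sum_congr rfl fun y hy => by rw [(Finset.mem_filter.1 hy).2],
          Finset.sum_const, hfib, smul_eq_mul]
    _ = s ^ (k + 1) * cyclicPsi k t := by
        rw [← hcard, ← sum_orderOf_pow_eq_cyclicPsi,
          Fintype.sum_equiv (Equiv.mulLeft (⟨z ^ s, hz⟩ : f.range))
            (fun w => orderOf ((⟨z ^ s, hz⟩ : f.range) * w) ^ k) (fun w => orderOf w ^ k)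
            fun _ => rfl]
        ring

variable {G : Type*} [Group G]

theorem sum_orderOf_pow_coset_le [Finite G] (k : ℕ) (N : Subgroup G) [N.Normal] [Fintype N]
    [IsCyclic N] (hN : N ≤ Subgroup.center G) (x : G) {r s t : ℕ}
    (hr : orderOf (x : G ⧸ N) = r) (hcard : Nat.card N = s * t) (hrt : r.Coprime t) :
    ∑ y : N, orderOf (x * y) ^ k ≤ r ^ k * (s ^ (k + 1) * cyclicPsi k t) := by
  let _ : CommGroup N := IsCyclic.commGroup
  have hx : x ^ r ∈ N := by
    rw [← QuotientGroup.eq_one_iff, QuotientGroup.mk_pow, ← hr, pow_orderOf_eq_one]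
  refine le_trans (le_of_eq ?_) (Nat.mul_le_mul_left (r ^ k)
    (sum_orderOf_mul_pow_le_of_isCyclic k (⟨x ^ r, hx⟩ : N) hcard hrt))
  rw [Finset.mul_sum]
  refine Finset.sum_congr rfl fun y _ => ?_
  rw [← mul_pow]
  congr 1
  have hxy : ((x * y : G) : G ⧸ N) = x := by
    rw [QuotientGroup.mk_mul, (QuotientGroup.eq_one_iff (y : G)).2 y.2, mul_one]
  have hdvd : r ∣ orderOf (x * y : G) := by
    rw [← hr, ← hxy]
    exact orderOf_map_dvd (QuotientGroup.mk' N) (x * y : G)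
  have hr0 : r ≠ 0 := hr ▸ (orderOf_pos _).ne'
  have hc : Commute x (y : G) := Subgroup.mem_center_iff.1 (hN y.2) x
  have hpow : (((⟨x ^ r, hx⟩ : N) * y ^ r : N) : G) = (x * y) ^ r := by
    rw [hc.mul_pow]
    rfl
  rw [← Subgroup.orderOf_coe, hpow, orderOf_pow_of_dvd hr0 hdvd, Nat.mul_div_cancel' hdvd]

theorem sum_orderOf_pow_coset_le_of_prime [Finite G] (k : ℕ) (N : Subgroup G) [N.Normal]
    [Fintype N] [IsCyclic N] (hN : N ≤ Subgroup.center G) (x : G) {r : ℕ} (hp : r.Prime)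
    (hr : orderOf (x : G ⧸ N) = r) :
    (∑ y : N, orderOf (x * y) ^ k : ℚ) ≤
      (if r ∣ Nat.card N then (r : ℚ) / (r - 1) else 1) * r ^ k * cyclicPsi k (Nat.card N) := by
  obtain ⟨e, t, ht, hcard⟩ := Nat.exists_eq_pow_mul_and_not_dvd
    (Nat.card_pos (α := N)).ne' r hp.ne_one
  have hrt : r.Coprime t := (Nat.Prime.coprime_iff_not_dvd hp).2 ht
  have hst : (r ^ e).Coprime t := hrt.pow_left e
  have h1 := sum_orderOf_pow_coset_le k N hN x hr hcard hrt
  rw [hcard, cyclicPsi_mul k hst]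
  have h1' : (∑ y : N, orderOf (x * y) ^ k : ℚ) ≤
      r ^ k * (((r ^ e : ℕ) : ℚ) ^ (k + 1) * cyclicPsi k t) := by exact_mod_cast h1
  refine h1'.trans ?_
  have hr1 : (1 : ℚ) < r := by exact_mod_cast hp.one_lt
  obtain _ | e := e
  · rw [if_neg (by simpa using ht)]
    have : cyclicPsi k 1 = 1 := by simp [cyclicPsi]
    simp [this]
  · rw [if_pos (Dvd.dvd.mul_right (dvd_pow_self r (Nat.succ_ne_zero e)) t)]
    have h2 : ((r : ℚ) - 1) * ((r ^ (e + 1) : ℕ) : ℚ) ^ (k + 1) ≤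
        r * cyclicPsi k (r ^ (e + 1)) := by
      have := pow_succ_le_cyclicPsi k hp e
      rw [← Nat.cast_pred hp.pos]
      exact_mod_cast this
    have h3 : ((r ^ (e + 1) : ℕ) : ℚ) ^ (k + 1) ≤
        r / (r - 1) * cyclicPsi k (r ^ (e + 1)) := by
      rw [div_mul_eq_mul_div, le_div_iff₀ (by linarith)]
      linarith
    push_cast at h3 ⊢
    have h4 : (0 : ℚ) ≤ r ^ k * cyclicPsi k t := by positivity
    have h5 := mul_le_mul_of_nonneg_right h3 h4
    linarith

theorem sum_eq_sum_sum_coset [Fintype G] (N : Subgroup G) [Fintype N] [Fintype (G ⧸ N)]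
    (F : G → ℚ) : ∑ g : G, F g = ∑ q : G ⧸ N, ∑ y : N, F (q.out * y) := by
  classical
  rw [← Finset.sum_fiberwise Finset.univ (fun g : G => (g : G ⧸ N))]
  refine Finset.sum_congr rfl fun q _ => ?_
  refine Finset.sum_bij' (fun g hg => ⟨q.out⁻¹ * g, ?_⟩) (fun y _ => q.out * y) ?_ ?_ ?_ ?_ ?_
  · rw [← QuotientGroup.eq, QuotientGroup.out_eq', (Finset.mem_filter.1 hg).2]
  · exact fun _ _ => Finset.mem_univ _
  · intro y _
    refine Finset.mem_filter.2 ⟨Finset.mem_univ _, ?_⟩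
    rw [QuotientGroup.mk_mul_of_mem _ y.2, QuotientGroup.out_eq']
  · intro g _
    simp
  · intro y _
    simp
  · intro g _
    simp

end CosetSum

/-- A normal cyclic subgroup whose quotient is a nonsolvable group of order `60` is central. -/
theorem Subgroup.le_center_of_index_eq_sixty {G : Type*} [Group G] [Finite G]
    (N : Subgroup G) [N.Normal] [IsCyclic N] (hN : N.index = 60) (hG : ¬ Group.IsSolvable (G ⧸ N)) :
    N ≤ Subgroup.center G := by
  let f : G →* MulAut N := MulAut.conjNormal
  let _ : CommGroup N := IsCyclic.commGroup
  have hfN : N ≤ f.ker := by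
    intro x hx
    rw [MonoidHom.mem_ker]
    ext y
    rw [MulAut.conjNormal_apply, mul_inv_eq_iff_eq_mul]
    exact congrArg Subtype.val (mul_comm (⟨x, hx⟩ : N) y)
  have hr : Group.IsSolvable f.range := by
    refine Group.isSolvable_of_comm fun a b => Subtype.ext ?_
    refine (IsCyclic.mulAutMulEquiv N).injective ?_
    rw [Subgroup.coe_mul, Subgroup.coe_mul, map_mul, map_mul, mul_comm]
  rcases Subgroup.eq_bot_or_eq_top_of_card_eq_sixty hN hG (f.ker.map (QuotientGroup.mk' N)) with
    h | h
  · exfalso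
    have hker : f.ker ≤ N := by
      rwa [Subgroup.map_eq_bot_iff, QuotientGroup.ker_mk'] at h
    have hk : Group.IsSolvable f.ker := by
      refine Group.isSolvable_of_comm fun a b => Subtype.ext ?_
      have : (a * b : G) = b * a :=
        congrArg Subtype.val (mul_comm (⟨a, hker a.2⟩ : N) ⟨b, hker b.2⟩)
      exact this
    have := MonoidHom.isSolvable_of_ker_range f hk hr
    exact hG inferInstance
  · have htop : f.ker = ⊤ := by
      rw [eq_top_iff, ← Subgroup.comap_top (QuotientGroup.mk' N), ← h, Subgroup.comap_map_eq,
        QuotientGroup.ker_mk', sup_eq_left.2 hfN]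
    intro x hx
    refine Subgroup.mem_center_iff.2 fun g => ?_
    have hg : f g = 1 := by
      rw [← MonoidHom.mem_ker, htop]
      trivial
    have := MulAut.conjNormal_apply g (⟨x, hx⟩ : N)
    rw [show MulAut.conjNormal g = (1 : MulAut N) from hg] at this
    exact (mul_inv_eq_iff_eq_mul.1 this.symm)

theorem sum_weight_le_mul_ratio {X Y Z : ℚ} (hX : 1 ≤ X) (hXY : 2 * X ≤ Y) (hYZ : 2 * Y ≤ Z) (hY : 9 ≤ Y)
    (m : ℕ) :
    1 + 15 * ((if 2 ∣ m then 2 else 1) * X) + 20 * ((if 3 ∣ m then 3 / 2 else 1) * Y) +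
      24 * ((if 5 ∣ m then 5 / 4 else 1) * Z) ≤
    (1 + 15 * X + 20 * Y + 24 * Z) * ((if 2 ∣ m then 3 / 2 else 1) *
      (if 3 ∣ m then 4 / 3 else 1) * (if 5 ∣ m then 5 / 4 - 3 / (8 * Z) else 1)) := by
  obtain ⟨d, hd⟩ : ∃ d, d = 3 / (8 * Z) := ⟨_, rfl⟩
  have hZ : 0 < Z := by linarith
  have hdZ : d * Z = 3 / 8 := by rw [hd]; field_simp
  have hd0 : 0 ≤ d := by rw [hd]; positivity
  have hdY : d * Y ≤ 3 / 16 := by nlinarith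
  have hdX : d * X ≤ 3 / 32 := by nlinarith
  have hd1 : d ≤ 3 / 32 := by nlinarith
  rw [← hd]
  split_ifs <;> nlinarith

theorem two_pow_le_three_pow {k : ℕ} (hk : 13 ≤ k) : (2 : ℚ) * 2 ^ k ≤ 3 ^ k := by
  obtain ⟨j, rfl⟩ := Nat.exists_eq_add_of_le hk
  have : (2 : ℚ) ^ j ≤ 3 ^ j := pow_le_pow_left₀ (by norm_num) (by norm_num) j
  rw [pow_add, pow_add]
  have h0 : (0 : ℚ) ≤ 2 ^ j := by positivity
  norm_num
  linarith

theorem three_pow_le_five_pow {k : ℕ} (hk : 13 ≤ k) : (2 : ℚ) * 3 ^ k ≤ 5 ^ k := by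
  obtain ⟨j, rfl⟩ := Nat.exists_eq_add_of_le hk
  have : (3 : ℚ) ^ j ≤ 5 ^ j := pow_le_pow_left₀ (by norm_num) (by norm_num) j
  rw [pow_add, pow_add]
  have h0 : (0 : ℚ) ≤ 3 ^ j := by positivity
  norm_num
  linarith

theorem cyclicPsi_sixty_mul {k m : ℕ} (hk : 3 ≤ k) (hm : m ≠ 0) :
    ((if 2 ∣ m then 3 / 2 else 1) * (if 3 ∣ m then 4 / 3 else 1) *
      (if 5 ∣ m then 5 / 4 - 3 / (8 * 5 ^ k) else 1) : ℚ) *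
      ((1 + 2 ^ k + 2 * 4 ^ k) * (1 + 2 * 3 ^ k) * (1 + 4 * 5 ^ k)) * cyclicPsi k m ≤
      cyclicPsi k (60 * m) := by
  have h4 := cyclicPsi_four_mul hk (u := 3 * (5 * m)) (by omega)
  have h3 := cyclicPsi_three_mul (k := k) (by omega) (u := 5 * m) (by omega)
  have h5 := cyclicPsi_five_mul (k := k) hm
  rw [show 4 * (3 * (5 * m)) = 60 * m by ring] at h4
  have e2 : 2 ∣ 3 * (5 * m) ↔ 2 ∣ m := by omega
  have e3 : 3 ∣ 5 * m ↔ 3 ∣ m := by omega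
  simp only [e2] at h4
  simp only [e3] at h3
  have p2 : (0 : ℚ) ≤ (if 2 ∣ m then 3 / 2 else 1) * (1 + 2 ^ k + 2 * 4 ^ k) := by
    split_ifs <;> positivity
  have p3 : (0 : ℚ) ≤ (if 3 ∣ m then 4 / 3 else 1) * (1 + 2 * 3 ^ k) := by
    split_ifs <;> positivity
  refine le_trans (le_of_eq ?_)
    ((mul_le_mul_of_nonneg_left ((mul_le_mul_of_nonneg_left h5 p3).trans h3) p2).trans h4)
  ring

theorem sum_orderOf_pow_mul_le_of_le_center {G : Type*} [Group G] [Fintype G] {k : ℕ} (hk : 13 ≤ k)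
    (N : Subgroup G) [N.Normal] [IsCyclic N] (hN : N.index = 60) (hNc : N ≤ Subgroup.center G)
    (hG : ¬ Group.IsSolvable (G ⧸ N)) :
    (∑ g : G, orderOf g ^ k : ℚ) *
      ((1 + 2 ^ k + 2 * 4 ^ k) * (1 + 2 * 3 ^ k) * (1 + 4 * 5 ^ k)) ≤
    (1 + 15 * 2 ^ k + 20 * 3 ^ k + 24 * 5 ^ k) * cyclicPsi k (Nat.card G) := by
  classical
  have := Fintype.ofFinite N
  have := Fintype.ofFinite (G ⧸ N)
  have h23 := two_pow_le_three_pow hk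
  have h35 := three_pow_le_five_pow hk
  have hX : (1 : ℚ) ≤ 2 ^ k := one_le_pow₀ (by norm_num)
  have hY : (9 : ℚ) ≤ 3 ^ k := by
    have : (3 : ℚ) ^ 2 ≤ 3 ^ k := pow_le_pow_right₀ (by norm_num) (by omega)
    linarith
  set m := Nat.card N with hm
  have hm0 : m ≠ 0 := Nat.card_pos.ne'
  have hcard : Nat.card G = 60 * m := by rw [← N.card_mul_index, hN, mul_comm]
  let c : ℕ → ℚ := fun r => if r = 1 then 1 else if r ∣ m then (r : ℚ) / (r - 1) else 1
  let w : ℕ → ℚ := fun r => c r * r ^ k * cyclicPsi k m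
  have hg : (0 : ℚ) ≤ cyclicPsi k m := Nat.cast_nonneg _
  have hc2 : c 2 = if 2 ∣ m then 2 else 1 := by simp only [c]; norm_num
  have hc3 : c 3 = if 3 ∣ m then 3 / 2 else 1 := by simp only [c]; norm_num
  have hc5 : c 5 = if 5 ∣ m then 5 / 4 else 1 := by simp only [c]; norm_num
  have hc23 : c 2 * 2 ^ k ≤ c 3 * 3 ^ k := by
    rw [hc2, hc3]
    split_ifs <;> linarith
  have hc25 : c 2 * 2 ^ k ≤ c 5 * 5 ^ k := by
    rw [hc2, hc5]
    split_ifs <;> linarith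
  have hcoset : ∀ q : G ⧸ N, (∑ y : N, orderOf (q.out * y) ^ k : ℚ) ≤ w (orderOf q) := by
    intro q
    have hq : orderOf ((q.out : G) : G ⧸ N) = orderOf q := by rw [QuotientGroup.out_eq']
    rcases orderOf_mem_of_card_eq_sixty hN hG q with h | h
    · rw [h] at hq ⊢
      have := sum_orderOf_pow_coset_le k N hNc q.out hq (one_mul m).symm (Nat.coprime_one_left m)
      simp only [one_pow, one_mul] at this
      simp only [w, c, if_true, Nat.cast_one, one_pow, one_mul]
      exact_mod_cast this
    · have hp : (orderOf q).Prime := by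
        rcases h with h | h | h <;> rw [h] <;> norm_num
      have := sum_orderOf_pow_coset_le_of_prime k N hNc q.out hp hq
      simpa only [w, c, if_neg hp.ne_one] using this
  have hsum : (∑ g : G, orderOf g ^ k : ℚ) ≤
      (1 + 15 * (c 2 * 2 ^ k) + 20 * (c 3 * 3 ^ k) + 24 * (c 5 * 5 ^ k)) * cyclicPsi k m := by
    rw [sum_eq_sum_sum_coset N]
    refine (Finset.sum_le_sum fun q _ => hcoset q).trans ?_
    refine (sum_weight_orderOf_le_of_card_eq_sixty hN hG w
      (mul_le_mul_of_nonneg_right hc23 hg) (mul_le_mul_of_nonneg_right hc25 hg)).trans_eq ?_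
    have hw1 : w 1 = cyclicPsi k m := by simp [w, c]
    rw [hw1]
    simp only [w]
    push_cast
    ring
  have hwt := sum_weight_le_mul_ratio hX h23 h35 hY m
  rw [← hc2, ← hc3, ← hc5] at hwt
  have h60 := cyclicPsi_sixty_mul (k := k) (by omega) hm0
  rw [← hcard] at h60
  have hD : (0 : ℚ) ≤ (1 + 2 ^ k + 2 * 4 ^ k) * (1 + 2 * 3 ^ k) * (1 + 4 * 5 ^ k) := by positivity
  have hW : (0 : ℚ) ≤ 1 + 15 * 2 ^ k + 20 * 3 ^ k + 24 * 5 ^ k := by positivity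
  refine (mul_le_mul_of_nonneg_right
    (hsum.trans (mul_le_mul_of_nonneg_right hwt hg)) hD).trans ?_
  refine le_trans (le_of_eq ?_) (mul_le_mul_of_nonneg_left h60 hW)
  ring

theorem totient_ge_of_primeFactors_le_seven {n : ℕ} (hmax : ∀ q : ℕ, q.Prime → q ∣ n → q ≤ 7) :
    (8 / 35 : ℚ) * n ≤ n.totient := by
  rw [Nat.totient_eq_mul_prod_factors, mul_comm]
  refine mul_le_mul_of_nonneg_left ?_ (Nat.cast_nonneg n)
  have hsub : n.primeFactors ⊆ {2, 3, 5, 7} := by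
    intro p hp
    have hp' := Nat.prime_of_mem_primeFactors hp
    have h7 := hmax p hp' (Nat.dvd_of_mem_primeFactors hp)
    interval_cases p <;> revert hp' <;> decide
  have hle : ∀ p ∈ n.primeFactors, (0 : ℚ) ≤ 1 - (p : ℚ)⁻¹ := fun p hp =>
    sub_nonneg.2 (Nat.cast_inv_le_one p)
  have h1 : ∏ p ∈ ({2, 3, 5, 7} : Finset ℕ) \ n.primeFactors, (1 - (p : ℚ)⁻¹) ≤ 1 :=
    Finset.prod_le_one (fun p _ => sub_nonneg.2 (Nat.cast_inv_le_one p))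
      (fun p _ => sub_le_self _ (by positivity))
  have h2 := Finset.prod_sdiff (f := fun p : ℕ => 1 - (p : ℚ)⁻¹) hsub
  have h3 : ∏ p ∈ ({2, 3, 5, 7} : Finset ℕ), (1 - (p : ℚ)⁻¹) = 8 / 35 := by
    norm_num
  rw [← h3, ← h2]
  exact mul_le_of_le_one_left (Finset.prod_nonneg hle) h1

theorem ratio_mul_fourteen_pow_ge {k : ℕ} (hk : 13 ≤ k) :
    35 * ((1 + 2 ^ k + 2 * 4 ^ k) * (1 + 2 * 3 ^ k) * (1 + 4 * 5 ^ k)) ≤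
      (8 * (1 + 15 * 2 ^ k + 20 * 3 ^ k + 24 * 5 ^ k) * 14 ^ k : ℚ) := by
  have h67 : (4 : ℚ) * (2 ^ k * 3 ^ k) ≤ 7 ^ k := by
    rw [← mul_pow]
    obtain ⟨j, rfl⟩ := Nat.exists_eq_add_of_le hk
    have : (6 : ℚ) ^ j ≤ 7 ^ j := pow_le_pow_left₀ (by norm_num) (by norm_num) j
    norm_num [pow_add]
    linarith [show (0 : ℚ) ≤ 6 ^ j by positivity]
  have hX : (8192 : ℚ) ≤ 2 ^ k := by
    have : (2 : ℚ) ^ 13 ≤ 2 ^ k := pow_le_pow_right₀ (by norm_num) hk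
    linarith
  have hXY := two_pow_le_three_pow hk
  have hYZ := three_pow_le_five_pow hk
  have e4 : (4 : ℚ) ^ k = 2 ^ k * 2 ^ k := by rw [← mul_pow]; norm_num
  have e14 : (14 : ℚ) ^ k = 2 ^ k * 7 ^ k := by rw [← mul_pow]; norm_num
  rw [e4, e14]
  generalize (2 : ℚ) ^ k = X at *
  generalize (3 : ℚ) ^ k = Y at *
  generalize (5 : ℚ) ^ k = Z at *
  generalize (7 : ℚ) ^ k = S at *
  have hX0 : 0 ≤ X := by linarith
  have hY0 : 0 ≤ Y := by linarith
  have hZ0 : 0 ≤ Z := by linarith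
  have hA : 1 + X + 2 * (X * X) ≤ 21 / 10 * (X * X) := by nlinarith
  have hB : 1 + 2 * Y ≤ 21 / 10 * Y := by linarith
  have hC : 1 + 4 * Z ≤ 41 / 10 * Z := by linarith
  calc 35 * ((1 + X + 2 * (X * X)) * (1 + 2 * Y) * (1 + 4 * Z))
      ≤ 35 * ((21 / 10 * (X * X)) * (21 / 10 * Y) * (41 / 10 * Z)) := by gcongr
    _ ≤ 8 * (24 * Z) * (X * (4 * (X * Y))) := by
      have : 0 ≤ X * X * Y * Z := by positivity
      linarith
    _ ≤ 8 * (1 + 15 * X + 20 * Y + 24 * Z) * (X * S) := by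
      gcongr
      linarith

theorem exists_index_zpowers_le_thirteen {G : Type*} [Group G] [Fintype G] {k : ℕ} (hk : 13 ≤ k)
    (hmax : ∀ q : ℕ, q.Prime → q ∣ Nat.card G → q ≤ 7)
    (h : (1 + 15 * 2 ^ k + 20 * 3 ^ k + 24 * 5 ^ k) * (cyclicPsi k (Nat.card G) : ℚ) <
      (∑ g : G, orderOf g ^ k : ℚ) *
        ((1 + 2 ^ k + 2 * 4 ^ k) * (1 + 2 * 3 ^ k) * (1 + 4 * 5 ^ k))) :
    ∃ a : G, (Subgroup.zpowers a).index ≤ 13 := by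
  by_contra! hidx
  have hn : Nat.card G ≠ 0 := Nat.card_pos.ne'
  have hord : ∀ g : G, 14 * orderOf g ≤ Nat.card G := by
    intro g
    rw [← (Subgroup.zpowers g).card_mul_index, Nat.card_zpowers, mul_comm]
    exact Nat.mul_le_mul_left _ (hidx g)
  have h1 : (14 : ℚ) ^ k * ∑ g : G, (orderOf g : ℚ) ^ k ≤ Nat.card G * (Nat.card G : ℚ) ^ k := by
    rw [Finset.mul_sum]
    refine (Finset.sum_le_sum (g := fun _ => (Nat.card G : ℚ) ^ k) fun g _ => ?_).trans_eq ?_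
    · rw [← mul_pow]
      exact pow_le_pow_left₀ (by positivity) (by exact_mod_cast hord g) k
    · rw [Finset.sum_const, Finset.card_univ, Nat.card_eq_fintype_card, nsmul_eq_mul]
  have h2 : (Nat.card G).totient * (Nat.card G : ℚ) ^ k ≤ cyclicPsi k (Nat.card G) := by
    exact_mod_cast totient_mul_pow_le_cyclicPsi k hn
  have h3 := totient_ge_of_primeFactors_le_seven hmax
  have h4 := ratio_mul_fourteen_pow_ge hk
  set D : ℚ := (1 + 2 ^ k + 2 * 4 ^ k) * (1 + 2 * 3 ^ k) * (1 + 4 * 5 ^ k) with hDdef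
  set W : ℚ := 1 + 15 * 2 ^ k + 20 * 3 ^ k + 24 * 5 ^ k with hWdef
  have hD : 0 < D := by positivity
  have hW : 0 < W := by positivity
  set P : ℚ := (Nat.card G : ℚ) ^ k with hP
  have hP0 : 0 ≤ P := by positivity
  set T : ℚ := 14 ^ k with hT
  have hT0 : 0 < T := by positivity
  set n : ℚ := (Nat.card G : ℚ) with hnn
  have hn0 : 0 ≤ n := Nat.cast_nonneg _
  have h5 : 8 / 35 * n * P ≤ cyclicPsi k (Nat.card G) :=
    (mul_le_mul_of_nonneg_right h3 hP0).trans h2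
  have h6 := mul_lt_mul_of_pos_left h hT0
  have h7 := mul_le_mul_of_nonneg_right h1 hD.le
  have h8 := mul_le_mul_of_nonneg_left h5 (mul_pos hT0 hW).le
  have h9 := mul_le_mul_of_nonneg_right h4 (mul_nonneg hn0 hP0)
  linarith

theorem solvable_of_psi_gt_of_largest_prime_eq_seven
    (G : Type*) [Group G] [Fintype G] (n : ℕ) [NeZero n] (hn : Fintype.card G = n)
    (h7n : (7 : ℕ) ∣ n) (hmax : ∀ q : ℕ, q.Prime → q ∣ n → q ≤ 7)
    (k : ℕ) (hk : 13 ≤ k)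
    (h : (psi G k : ℚ) >
        ((1 + 15 * 2 ^ k + 20 * 3 ^ k + 24 * 5 ^ k : ℚ) /
          ((1 + 2 ^ k + 2 * 4 ^ k) * (1 + 2 * 3 ^ k) * (1 + 4 * 5 ^ k))) *
        (psi (Multiplicative (ZMod n)) k : ℚ)) :
    IsSolvable G := by
  change Group.IsSolvable G
  by_contra hG
  have hcard : Nat.card G = n := by rw [Nat.card_eq_fintype_card, hn]
  have hpsi : psi (Multiplicative (ZMod n)) k = cyclicPsi k (Nat.card G) := by
    rw [psi, sum_orderOf_pow_eq_cyclicPsi, hcard, Nat.card_eq_fintype_card,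
      Fintype.card_multiplicative, ZMod.card]
  have hlt : (1 + 15 * 2 ^ k + 20 * 3 ^ k + 24 * 5 ^ k) * (cyclicPsi k (Nat.card G) : ℚ) <
      (∑ g : G, orderOf g ^ k : ℚ) *
        ((1 + 2 ^ k + 2 * 4 ^ k) * (1 + 2 * 3 ^ k) * (1 + 4 * 5 ^ k)) := by
    rw [gt_iff_lt, hpsi, div_mul_eq_mul_div, div_lt_iff₀ (by positivity)] at h
    rw [psi] at h
    push_cast at h
    exact h
  obtain ⟨a, ha⟩ := exists_index_zpowers_le_thirteen hk (hcard ▸ hmax) hlt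
  obtain ⟨N, hN, hNa, hidx⟩ := Subgroup.exists_normal_index_eq_sixty hG ha
  have hcyc : IsCyclic N := isCyclic_of_injective (Subgroup.inclusion hNa)
    (Subgroup.inclusion_injective hNa)
  have hQ : ¬ Group.IsSolvable (G ⧸ N) := fun hQ => hG <|
    (Group.isSolvable_iff_subgroup_quotient N).2
      ⟨(let _ : CommGroup N := IsCyclic.commGroup; Group.isSolvable_of_comm mul_comm), hQ⟩
  exact hlt.not_ge (sum_orderOf_pow_mul_le_of_le_center hk N hidx
    (N.le_center_of_index_eq_sixty hidx hQ) hQ)
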